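/- arXiv:1404.3348 — 10 statements merged into one kernel-verified Lean document; each statement's English description precedes it below -/
import Mathlib

section
/- Let X be a finite set and for each x ∈ X let Φ_x be a linear map on d×d complex matrices that is positive (it maps positive semidefinite matrices to positive semidefinite matrices). Assume normalization: ∑_{x∈X} Tr(Φ_x(A)) = Tr(A) for every matrix A, and repeatability: Tr(Φ_x(Φ_x(A))) = Tr(Φ_x(A)) for every positive semidefinite A and every x. Then for all x ≠ x' and every positive semidefinite matrix A, Tr(Φ_{x'}(Φ_x(A))) = 0. That is, a repeatable instrument never produces a different outcome upon immediate re-measurement. -/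
open ComplexOrder

/-- A repeatable instrument never produces a different outcome upon immediate
re-measurement: if `{Φ x}` is a finite family of positive linear maps on `d × d`
complex matrices with `∑ x, Tr(Φ x A) = Tr A` for every `A` (normalization) and
`Tr(Φ x (Φ x A)) = Tr(Φ x A)` for every positive semidefinite `A` (repeatability),
then `Tr(Φ x' (Φ x A)) = 0` for `x' ≠ x` and every positive semidefinite `A`. -/
theorem repeatable_instrument_no_other_outcome {d : ℕ} {X : Type*} [Fintype X]
    (Φ : X → Matrix (Fin d) (Fin d) ℂ →ₗ[ℂ] Matrix (Fin d) (Fin d) ℂ)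
    (hpos : ∀ x, ∀ A : Matrix (Fin d) (Fin d) ℂ, A.PosSemidef → (Φ x A).PosSemidef)
    (hnorm : ∀ A : Matrix (Fin d) (Fin d) ℂ, ∑ x, (Φ x A).trace = A.trace)
    (hrep : ∀ x, ∀ A : Matrix (Fin d) (Fin d) ℂ, A.PosSemidef →
      (Φ x (Φ x A)).trace = (Φ x A).trace)
    (x x' : X) (hxx' : x ≠ x')
    (A : Matrix (Fin d) (Fin d) ℂ) (hA : A.PosSemidef) :
    (Φ x' (Φ x A)).trace = 0 := by
  classical
  have hsum := hnorm (Φ x A)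
  rw [← Finset.add_sum_erase _ _ (Finset.mem_univ x), hrep x A hA, add_eq_left] at hsum
  exact (Finset.sum_eq_zero_iff_of_nonneg
    fun y _ => (hpos y _ (hpos x A hA)).trace_nonneg).1 hsum x'
      (Finset.mem_erase.2 ⟨hxx'.symm, Finset.mem_univ x'⟩)
end

section
/- Let X and Y be finite sets, and for each x ∈ X let Φ_x be a positive linear map on d×d complex matrices with ∑_{x∈X} Tr(Φ_x(A)) = Tr(A) for every matrix A. Let {r_{x,y}}_{x∈X,y∈Y} be positive semidefinite matrices with ∑_{x,y} r_{x,y} = I, and assume the refinement-invariance condition Tr(r_{x,y} * Φ_x(A)) = Tr(r_{x,y} * A) for all x, y and all matrices A. Define n_y = ∑_{x∈X} r_{x,y}. Then for every y ∈ Y and every matrix A, ∑_{x∈X} Tr(n_y * Φ_x(A)) = Tr(n_y * A). That is, the instrument {Φ_x} does not disturb any measurement {n_y} that is jointly measurable with its associated measurement. -/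
open ComplexOrder

open scoped MatrixOrder Matrix.Norms.L2Operator in
/-- The trace of a product of two positive semidefinite matrices is nonnegative. -/
theorem Matrix.PosSemidef.trace_mul_nonneg {n : Type*} [Fintype n] [DecidableEq n]
    {A B : Matrix n n ℂ} (hA : A.PosSemidef) (hB : B.PosSemidef) : 0 ≤ (A * B).trace := by
  obtain ⟨C, rfl⟩ := CStarAlgebra.nonneg_iff_eq_star_mul_self.mp hA.nonneg
  rw [Matrix.mul_assoc, Matrix.trace_mul_comm]
  exact (hB.mul_mul_conjTranspose_same C).trace_nonneg

open scoped MatrixOrder Matrix.Norms.L2Operator in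
/-- Every complex square matrix is a linear combination of positive semidefinite ones. -/
theorem Matrix.span_posSemidef {n : Type*} [Fintype n] [DecidableEq n] :
    Submodule.span ℂ {A : Matrix n n ℂ | A.PosSemidef} = ⊤ := by
  simpa only [Matrix.nonneg_iff_posSemidef] using
    CStarAlgebra.span_nonneg (A := Matrix n n ℂ)

/-- Refinement invariance implies minimal disturbance: if the instrument `{Φ x}` leaves
invariant the statistics of a joint measurement `{r x y}` refining its associated
measurement, then it does not disturb the marginal measurement `n y = ∑ x, r x y`. -/
theorem refinement_invariance_implies_no_disturbance {d : ℕ} {X Y : Type*}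
    [Fintype X] [Fintype Y]
    (Φ : X → Matrix (Fin d) (Fin d) ℂ →ₗ[ℂ] Matrix (Fin d) (Fin d) ℂ)
    (hpos : ∀ x, ∀ A : Matrix (Fin d) (Fin d) ℂ, A.PosSemidef → (Φ x A).PosSemidef)
    (hnorm : ∀ A : Matrix (Fin d) (Fin d) ℂ, ∑ x, (Φ x A).trace = A.trace)
    (r : X → Y → Matrix (Fin d) (Fin d) ℂ)
    (hrpos : ∀ x y, (r x y).PosSemidef)
    (hrsum : ∑ x, ∑ y, r x y = 1)
    (hinv : ∀ x y, ∀ A : Matrix (Fin d) (Fin d) ℂ,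
      (r x y * Φ x A).trace = (r x y * A).trace)
    (y : Y) (A : Matrix (Fin d) (Fin d) ℂ) :
    ∑ x, ((∑ x', r x' y) * Φ x A).trace = ((∑ x', r x' y) * A).trace := by
  have hA : A ∈ Submodule.span ℂ {B : Matrix (Fin d) (Fin d) ℂ | B.PosSemidef} := by
    rw [Matrix.span_posSemidef]
    trivial
  induction hA using Submodule.span_induction with
  | zero => simp
  | add B C _ _ hB hC =>
    simp only [map_add, mul_add, Matrix.trace_add, Finset.sum_add_distrib, hB, hC]
  | smul c B _ hB =>
    simp only [map_smul, Matrix.mul_smul, Matrix.trace_smul, ← Finset.smul_sum, hB]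
  | mem B hB =>
    -- The claimed equality holds as an inequality for each `y`, and the sums over `y` agree.
    have hle : ∀ z ∈ Finset.univ, ((∑ x', r x' z) * B).trace ≤
        ∑ x, ((∑ x', r x' z) * Φ x B).trace := by
      intro z _
      rw [Finset.sum_mul, Matrix.trace_sum]
      refine Finset.sum_le_sum fun x _ => ?_
      rw [← hinv x z B, Finset.sum_mul, Matrix.trace_sum]
      exact Finset.single_le_sum (f := fun x' => (r x' z * Φ x B).trace)
        (fun x' _ => (hrpos x' z).trace_mul_nonneg (hpos x B hB)) (Finset.mem_univ x)
    have hone : ∑ z, ∑ x', r x' z = 1 := by rw [Finset.sum_comm, hrsum]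
    have hsum : ∑ z, ((∑ x', r x' z) * B).trace =
        ∑ z, ∑ x, ((∑ x', r x' z) * Φ x B).trace := by
      rw [Finset.sum_comm]
      simp only [← Matrix.trace_sum, ← Finset.sum_mul, hone, one_mul]
      rw [Matrix.trace_sum, hnorm]
    exact ((Finset.sum_eq_sum_iff_of_le hle).mp hsum y (Finset.mem_univ y)).symm
end

section
/- (Naimark dilation) Let {m_x}_{x∈X} be a POVM on ℂ^d: a finite family of positive semidefinite Hermitian d×d complex matrices with ∑_{x∈X} m_x = I. Then there exist a finite dimension n, a density matrix σ on ℂ^n, and a projective measurement {M_x}_{x∈X} on ℂ^d ⊗ ℂ^n (a family of Hermitian idempotent (dn)×(dn) matrices summing to the identity, with the tensor product realized as the Kronecker product) such that for every d×d matrix ρ and every x ∈ X, Tr(m_x * ρ) = Tr(M_x * (ρ ⊗ σ)), where ρ ⊗ σ denotes the Kronecker product. -/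
open ComplexOrder
open scoped Kronecker

/-- The Halmos-type unitary `ι ⊕ κ → κ ⊕ ι` extending an isometry `V : ι → κ`. -/
noncomputable def isometryDilation {ι κ : Type*} [Fintype ι] [DecidableEq κ]
    (V : Matrix κ ι ℂ) : Matrix (κ ⊕ ι) (ι ⊕ κ) ℂ :=
  Matrix.fromBlocks V (1 - V * V.conjTranspose) 0 V.conjTranspose

theorem isometryDilation_conjTranspose_mul_self {ι κ : Type*} [Fintype ι] [Fintype κ]
    [DecidableEq ι] [DecidableEq κ] {V : Matrix κ ι ℂ} (hV : V.conjTranspose * V = 1) :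
    (isometryDilation V).conjTranspose * isometryDilation V = 1 := by
  have h₁ : V.conjTranspose * (V * V.conjTranspose) = V.conjTranspose := by
    rw [← Matrix.mul_assoc, hV, Matrix.one_mul]
  have h₂ : V * V.conjTranspose * V = V := by
    rw [Matrix.mul_assoc, hV, Matrix.mul_one]
  have h₃ : V * V.conjTranspose * (V * V.conjTranspose) = V * V.conjTranspose := by
    rw [Matrix.mul_assoc, h₁]
  simp [isometryDilation, Matrix.fromBlocks_conjTranspose, Matrix.fromBlocks_multiply, hV,
    Matrix.mul_sub, Matrix.sub_mul, h₁, h₂, h₃]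

theorem isometryDilation_mul_conjTranspose_self {ι κ : Type*} [Fintype ι] [Fintype κ]
    [DecidableEq ι] [DecidableEq κ] {V : Matrix κ ι ℂ} (hV : V.conjTranspose * V = 1) :
    isometryDilation V * (isometryDilation V).conjTranspose = 1 :=
  (Matrix.mul_eq_one_comm_of_equiv (Equiv.sumComm ι κ)).mp
    (isometryDilation_conjTranspose_mul_self hV)

/-- The compression of a projective measurement along an isometry `V : ι → κ` is the
corner of a projective measurement on `ι ⊕ κ`. -/
theorem exists_projective_toBlocks₁₁_eq {ι κ X : Type*} [Fintype ι] [Fintype κ] [Fintype X]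
    [DecidableEq ι] [DecidableEq κ] [Nonempty X] {V : Matrix κ ι ℂ}
    (hV : V.conjTranspose * V = 1) {P : X → Matrix κ κ ℂ} (hherm : ∀ x, (P x).IsHermitian)
    (hidem : ∀ x, P x * P x = P x) (hsum : ∑ x, P x = 1) :
    ∃ M : X → Matrix (ι ⊕ κ) (ι ⊕ κ) ℂ, (∀ x, (M x).IsHermitian) ∧
      (∀ x, M x * M x = M x) ∧ ∑ x, M x = 1 ∧
      ∀ x, (M x).toBlocks₁₁ = V.conjTranspose * P x * V := by
  classical
  obtain ⟨x₀⟩ := ‹Nonempty X›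
  let Q : X → Matrix ι ι ℂ := fun x => if x = x₀ then 1 else 0
  let R : X → Matrix (κ ⊕ ι) (κ ⊕ ι) ℂ := fun x => Matrix.fromBlocks (P x) 0 0 (Q x)
  have hR : ∀ x, (R x).IsHermitian := fun x =>
    (hherm x).fromBlocks (by simp) (by by_cases h : x = x₀ <;> simp [Q, h])
  have hRR : ∀ x, R x * R x = R x := fun x => by
    by_cases h : x = x₀ <;> simp [R, Q, Matrix.fromBlocks_multiply, hidem, h]
  have hRsum : ∑ x, R x = 1 := by
    have hQ : ∑ x, Q x = 1 := by simp [Q]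
    rw [← Matrix.fromBlocks_one, ← hsum, ← hQ]
    ext (i | i) (j | j) <;> simp [R, Matrix.sum_apply]
  refine ⟨fun x => (isometryDilation V).conjTranspose * R x * isometryDilation V,
    fun x => Matrix.isHermitian_conjTranspose_mul_mul _ (hR x), fun x => ?_, ?_, fun x => ?_⟩
  · calc _ = (isometryDilation V).conjTranspose * R x *
          (isometryDilation V * (isometryDilation V).conjTranspose) * R x *
            isometryDilation V := by simp only [Matrix.mul_assoc]
      _ = _ := by
        rw [isometryDilation_mul_conjTranspose_self hV, Matrix.mul_one,
          Matrix.mul_assoc _ (R x) (R x), hRR]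
  · rw [← Matrix.sum_mul, ← Matrix.mul_sum, hRsum, Matrix.mul_one,
      isometryDilation_conjTranspose_mul_self hV]
  · simp [R, isometryDilation, Matrix.fromBlocks_conjTranspose, Matrix.fromBlocks_multiply]

open scoped MatrixOrder Matrix.Norms.L2Operator in
theorem Matrix.PosSemidef.exists_eq_conjTranspose_mul_self {ι : Type*} [Fintype ι]
    [DecidableEq ι] {A : Matrix ι ι ℂ} (hA : A.PosSemidef) :
    ∃ B : Matrix ι ι ℂ, A = B.conjTranspose * B :=
  CStarAlgebra.nonneg_iff_eq_star_mul_self.mp hA.nonneg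

/-- Every POVM is the corner of a projective measurement on a larger space. -/
theorem exists_projective_toBlocks₁₁_eq_of_povm {ι X : Type*} [Fintype ι] [DecidableEq ι]
    [Fintype X] [DecidableEq X] [Nonempty X] {m : X → Matrix ι ι ℂ} (hpos : ∀ x, (m x).PosSemidef)
    (hsum : ∑ x, m x = 1) :
    ∃ M : X → Matrix (ι ⊕ ι × X) (ι ⊕ ι × X) ℂ, (∀ x, (M x).IsHermitian) ∧
      (∀ x, M x * M x = M x) ∧ ∑ x, M x = 1 ∧ ∀ x, (M x).toBlocks₁₁ = m x := by
  choose B hB using fun x => (hpos x).exists_eq_conjTranspose_mul_self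
  let V : Matrix (ι × X) ι ℂ := Matrix.of fun k j => B k.2 k.1 j
  let P : X → Matrix (ι × X) (ι × X) ℂ :=
    fun x => Matrix.diagonal fun k => if k.2 = x then 1 else 0
  have hVP : ∀ x, V.conjTranspose * P x * V = m x := fun x => by
    ext i j
    rw [hB, Matrix.mul_apply, Matrix.mul_apply]
    simp [V, P, Matrix.mul_diagonal, Fintype.sum_prod_type]
  have hPsum : ∑ x, P x = 1 := by
    ext k l
    by_cases h : k = l <;> simp [P, Matrix.sum_apply, Matrix.one_apply, h]
  have hV : V.conjTranspose * V = 1 := by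
    rw [← hsum, ← Finset.sum_congr rfl fun x _ => hVP x, ← Matrix.sum_mul, ← Matrix.mul_sum,
      hPsum, Matrix.mul_one]
  obtain ⟨M, hherm, hidem, hone, hcorner⟩ := exists_projective_toBlocks₁₁_eq (P := P) hV
    (fun x => by
      refine Matrix.isHermitian_diagonal_iff.mpr fun k => ?_
      by_cases h : k.2 = x <;> simp [h, IsSelfAdjoint])
    (fun x => by simp [P]) hPsum
  exact ⟨M, hherm, hidem, hone, fun x => (hcorner x).trans (hVP x)⟩

theorem trace_mul_kronecker_single {ι κ : Type*} [Fintype ι] [Fintype κ] [DecidableEq κ]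
    (M : Matrix (ι × κ) (ι × κ) ℂ) (ρ : Matrix ι ι ℂ) (a : κ) :
    (M * (ρ ⊗ₖ Matrix.single a a 1)).trace =
      (M.submatrix (fun i => (i, a)) (fun i => (i, a)) * ρ).trace := by
  simp [Matrix.trace, Matrix.mul_apply, Fintype.sum_prod_type, Matrix.single_apply, ite_and]

/-- Naimark dilation: every POVM `{m x}` on `ℂ^d` arises from a projective measurement
`{M x}` on `ℂ^d ⊗ ℂ^n` together with a fixed density matrix `σ` of the environment:
`Tr(m x * ρ) = Tr(M x * (ρ ⊗ σ))` for every state `ρ` and outcome `x`. -/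
theorem naimark_dilation {d : ℕ} {X : Type*} [Fintype X]
    (m : X → Matrix (Fin d) (Fin d) ℂ)
    (hpos : ∀ x, (m x).PosSemidef)
    (hsum : ∑ x, m x = 1) :
    ∃ (n : ℕ) (σ : Matrix (Fin n) (Fin n) ℂ)
      (M : X → Matrix (Fin d × Fin n) (Fin d × Fin n) ℂ),
      σ.PosSemidef ∧ σ.trace = 1 ∧
      (∀ x, (M x).IsHermitian) ∧
      (∀ x, M x * M x = M x) ∧
      (∑ x, M x = 1) ∧
      (∀ (ρ : Matrix (Fin d) (Fin d) ℂ) (x : X),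
        (m x * ρ).trace = (M x * (ρ ⊗ₖ σ)).trace) := by
  classical
  rcases isEmpty_or_nonempty X with hX | hX
  · have hd : IsEmpty (Fin d) := ⟨fun i => by simpa using congrFun (congrFun hsum i) i⟩
    exact ⟨1, 1, fun _ => 0, Matrix.PosSemidef.one, by simp, hX.elim, hX.elim,
      Subsingleton.elim _ _, fun _ => hX.elim⟩
  obtain ⟨M, hherm, hidem, hone, hcorner⟩ := exists_projective_toBlocks₁₁_eq_of_povm hpos hsum
  let g : Fin (Fintype.card (Unit ⊕ X)) ≃ Unit ⊕ X := (Fintype.equivFin _).symm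
  let a := g.symm (Sum.inl ())
  let e : Fin d × Fin (Fintype.card (Unit ⊕ X)) ≃ Fin d ⊕ Fin d × X :=
    ((Equiv.refl _).prodCongr g).trans
      ((Equiv.prodSumDistrib _ _ _).trans ((Equiv.prodPUnit _).sumCongr (Equiv.refl _)))
  have he : ∀ i, e (i, a) = Sum.inl i := fun i => by simp [e, a]
  refine ⟨_, Matrix.single a a 1, fun x => (M x).submatrix e e, ?_, by simp,
    fun x => (hherm x).submatrix e, fun x => ?_, ?_, fun ρ x => ?_⟩
  · rw [← Matrix.diagonal_single]
    exact Matrix.PosSemidef.diagonal (Pi.single_nonneg.mpr zero_le_one)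
  · rw [Matrix.submatrix_mul_equiv, hidem]
  · rw [← Matrix.submatrix_one_equiv e, ← hone]
    ext i j
    simp [Matrix.sum_apply]
  · rw [trace_mul_kronecker_single, ← hcorner x]
    congr 2
    ext i j
    simp [he, Matrix.toBlocks₁₁]
end

section
/- (Quantum Consistent Exclusivity) Let {P_y}_{y∈E} be a finite family of Hermitian idempotent d×d complex matrices (projections) such that for every pair y ≠ y' the matrix I − P_y − P_{y'} is positive semidefinite (i.e., every pair of them can coexist in a single measurement). Then for every density matrix ρ on ℂ^d, ∑_{y∈E} Tr(P_y * ρ) ≤ 1. -/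
open ComplexOrder

/-- Two projections whose sum is at most the identity are orthogonal. -/
theorem Matrix.mul_eq_zero_of_posSemidef_one_sub_sub {n : Type*} [Fintype n] [DecidableEq n]
    {P Q : Matrix n n ℂ} (hP : P.IsHermitian) (hQ : Q.IsHermitian)
    (hP2 : P * P = P) (hQ2 : Q * Q = Q) (h : (1 - P - Q).PosSemidef) : Q * P = 0 := by
  have hle := (h.conjTranspose_mul_mul_same P).trace_nonneg
  have heq : P.conjTranspose * (1 - P - Q) * P = -((Q * P).conjTranspose * (Q * P)) := by
    rw [Matrix.conjTranspose_mul, hP.eq, hQ.eq]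
    calc P * (1 - P - Q) * P = P * P - P * P * P - P * Q * P := by noncomm_ring
      _ = -(P * (Q * Q) * P) := by rw [hP2, hP2, hQ2, sub_self, zero_sub]
      _ = -(P * Q * (Q * P)) := by noncomm_ring
  rw [heq, Matrix.trace_neg, Left.nonneg_neg_iff] at hle
  exact Matrix.trace_conjTranspose_mul_self_eq_zero_iff.mp
    (le_antisymm hle (Matrix.posSemidef_conjTranspose_mul_self _).trace_nonneg)

/-- The trace of the product of a projection and a positive semidefinite matrix is nonnegative. -/
theorem Matrix.PosSemidef.trace_projection_mul_nonneg {n : Type*} [Fintype n]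
    {Q ρ : Matrix n n ℂ} (hρ : ρ.PosSemidef) (hQ : Q.IsHermitian) (hQ2 : Q * Q = Q) :
    0 ≤ (Q * ρ).trace := by
  have h := (hρ.mul_mul_conjTranspose_same Q).trace_nonneg
  rwa [hQ.eq, Matrix.trace_mul_comm, ← Matrix.mul_assoc, hQ2] at h

/-- Quantum Consistent Exclusivity: if `{P y}` are projections such that for every pair
`y ≠ y'` the matrix `I - P y - P y'` is positive semidefinite (pairwise exclusivity),
then for every density matrix `ρ` the probabilities `Tr(P y * ρ)` sum to at most `1`. -/
theorem quantum_consistent_exclusivity {d : ℕ} {E : Type*} [Fintype E]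
    (P : E → Matrix (Fin d) (Fin d) ℂ)
    (hherm : ∀ y, (P y).IsHermitian)
    (hidem : ∀ y, P y * P y = P y)
    (hexcl : ∀ y y', y ≠ y' → (1 - P y - P y').PosSemidef)
    (ρ : Matrix (Fin d) (Fin d) ℂ)
    (hρ : ρ.PosSemidef) (hρtr : ρ.trace = 1) :
    ∑ y, ((P y * ρ).trace).re ≤ 1 := by
  have hS2 : (∑ y, P y) * ∑ y, P y = ∑ y, P y := by
    rw [Finset.sum_mul_sum]
    refine Finset.sum_congr rfl fun y _ => ?_
    rw [Finset.sum_eq_single y _ (by simp), hidem]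
    exact fun z _ hz => Matrix.mul_eq_zero_of_posSemidef_one_sub_sub (hherm z) (hherm y)
      (hidem z) (hidem y) (hexcl z y hz)
  have hS : (∑ y, P y).IsHermitian := by
    rw [Matrix.IsHermitian, Matrix.conjTranspose_sum]
    exact Finset.sum_congr rfl fun y _ => (hherm y).eq
  have hnonneg := hρ.trace_projection_mul_nonneg (Matrix.isHermitian_one.sub hS)
    (IsIdempotentElem.one_sub hS2)
  rw [Matrix.sub_mul, Matrix.one_mul, Matrix.trace_sub, hρtr, Finset.sum_mul,
    Matrix.trace_sum] at hnonneg
  simpa using (Complex.le_def.mp hnonneg).1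
end

section
/- (Quantum CE hierarchy, level L) Let {P_y}_{y∈Y} be a finite family of Hermitian idempotent d×d complex matrices (projections). Call two strings y = (y_1,…,y_L) and y' = (y'_1,…,y'_L) in Y^L exclusive if there exists an index i with P_{y_i} * P_{y'_i} = 0 and y_i ≠ y'_i. Then for every set E ⊆ Y^L of pairwise exclusive strings and every density matrix ρ on ℂ^d, ∑_{y∈E} ∏_{i=1}^L Tr(P_{y_i} * ρ) ≤ 1. -/
open ComplexOrder

namespace Matrix

/-- The tensor product of a finite family of square matrices of the same size, with rows and
columns indexed by strings. -/
def piTensor {ι n R : Type*} [Fintype ι] [CommSemiring R] (A : ι → Matrix n n R) :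
    Matrix (ι → n) (ι → n) R :=
  of fun f g => ∏ i, A i (f i) (g i)

section piTensor

variable {ι n R : Type*} [Fintype ι] [CommSemiring R]

theorem piTensor_apply (A : ι → Matrix n n R) (f g : ι → n) :
    piTensor A f g = ∏ i, A i (f i) (g i) := rfl

theorem piTensor_mul [DecidableEq ι] [Fintype n] (A B : ι → Matrix n n R) :
    piTensor A * piTensor B = piTensor fun i => A i * B i := by
  ext f g
  simp only [mul_apply, piTensor_apply, ← Finset.prod_mul_distrib, Finset.prod_univ_sum,
    Fintype.piFinset_univ]

theorem trace_piTensor [DecidableEq ι] [Fintype n] (A : ι → Matrix n n R) :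
    (piTensor A).trace = ∏ i, (A i).trace := by
  simp only [trace, diag_apply, piTensor_apply, Finset.prod_univ_sum, Fintype.piFinset_univ]

theorem conjTranspose_piTensor [StarRing R] (A : ι → Matrix n n R) :
    (piTensor A)ᴴ = piTensor fun i => (A i)ᴴ := by
  ext f g
  simp only [conjTranspose_apply, piTensor_apply, star_prod]

theorem piTensor_eq_zero {A : ι → Matrix n n R} {i : ι} (h : A i = 0) : piTensor A = 0 := by
  ext f g
  exact Finset.prod_eq_zero (Finset.mem_univ i) (by simp [h])

end piTensor

variable {ι n : Type*} [Fintype n]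

open scoped MatrixOrder Matrix.Norms.L2Operator in
theorem PosSemidef.exists_eq_conjTranspose_mul_self_s8 {A : Matrix n n ℂ} (hA : A.PosSemidef) :
    ∃ B : Matrix n n ℂ, A = Bᴴ * B := by
  classical
  exact CStarAlgebra.nonneg_iff_eq_star_mul_self.mp hA.nonneg

theorem PosSemidef.piTensor [Fintype ι] [DecidableEq ι] {A : ι → Matrix n n ℂ}
    (hA : ∀ i, (A i).PosSemidef) : (piTensor A).PosSemidef := by
  choose B hB using fun i => (hA i).exists_eq_conjTranspose_mul_self_s8
  obtain rfl : A = fun i => (B i)ᴴ * B i := funext hB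
  rw [← piTensor_mul, ← conjTranspose_piTensor]
  exact posSemidef_conjTranspose_mul_self _

theorem PosSemidef.of_isHermitian_of_isIdempotentElem {Q : Matrix n n ℂ} (hQ : Q.IsHermitian)
    (hQQ : IsIdempotentElem Q) : Q.PosSemidef := by
  have h := posSemidef_conjTranspose_mul_self Q
  rwa [hQ.eq, hQQ.eq] at h

theorem PosSemidef.trace_mul_nonneg_s8 {A B : Matrix n n ℂ} (hA : A.PosSemidef)
    (hB : B.PosSemidef) : 0 ≤ (A * B).trace := by
  obtain ⟨C, rfl⟩ := hB.exists_eq_conjTranspose_mul_self_s8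
  rw [← mul_assoc, trace_mul_comm, ← mul_assoc]
  exact (hA.mul_mul_conjTranspose_same C).trace_nonneg

/-- The probabilities of pairwise orthogonal projections sum to at most the trace of the state. -/
theorem sum_trace_mul_le_of_pairwise_mul_eq_zero {E : Finset ι} {Q : ι → Matrix n n ℂ}
    (hherm : ∀ y ∈ E, (Q y).IsHermitian) (hidem : ∀ y ∈ E, IsIdempotentElem (Q y))
    (horth : ∀ y ∈ E, ∀ y' ∈ E, y ≠ y' → Q y * Q y' = 0)
    {R : Matrix n n ℂ} (hR : R.PosSemidef) : ∑ y ∈ E, (Q y * R).trace ≤ R.trace := by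
  classical
  have hS : (∑ y ∈ E, Q y).IsHermitian := by
    rw [IsHermitian, conjTranspose_sum]
    exact Finset.sum_congr rfl fun y hy => hherm y hy
  have hSS : IsIdempotentElem (∑ y ∈ E, Q y) := by
    rw [IsIdempotentElem, Finset.sum_mul_sum]
    refine Finset.sum_congr rfl fun y hy => ?_
    rw [Finset.sum_eq_single_of_mem y hy fun y' hy' hne => horth y hy y' hy' hne.symm]
    exact hidem y hy
  have h := (PosSemidef.of_isHermitian_of_isIdempotentElem (isHermitian_one.sub hS)
    hSS.one_sub).trace_mul_nonneg_s8 hR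
  rwa [sub_mul, one_mul, trace_sub, Finset.sum_mul, trace_sum, sub_nonneg] at h

end Matrix

/-- Quantum CE hierarchy at level `L`: given projections `{P y}`, call two strings
`y y' : Fin L → Y` exclusive if `P (y i) * P (y' i) = 0` and `y i ≠ y' i` for some `i`.
Then for every set `E` of pairwise exclusive strings and every density matrix `ρ`,
`∑_{y ∈ E} ∏ i, Tr(P (y i) * ρ) ≤ 1`. -/
theorem quantum_CE_hierarchy {d L : ℕ} {Y : Type*} [Fintype Y]
    (P : Y → Matrix (Fin d) (Fin d) ℂ)
    (hherm : ∀ y, (P y).IsHermitian)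
    (hidem : ∀ y, P y * P y = P y)
    (E : Finset (Fin L → Y))
    (hexcl : ∀ y ∈ E, ∀ y' ∈ E, y ≠ y' →
      ∃ i, P (y i) * P (y' i) = 0 ∧ y i ≠ y' i)
    (ρ : Matrix (Fin d) (Fin d) ℂ)
    (hρ : ρ.PosSemidef) (hρtr : ρ.trace = 1) :
    ∑ y ∈ E, ∏ i, ((P (y i) * ρ).trace).re ≤ 1 := by
  have hreal (y : Y) : (((P y * ρ).trace.re : ℝ) : ℂ) = (P y * ρ).trace :=
    (Complex.eq_re_of_ofReal_le (r := 0) <| by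
      rw [Complex.ofReal_zero]
      exact (Matrix.PosSemidef.of_isHermitian_of_isIdempotentElem (hherm y)
        (hidem y)).trace_mul_nonneg_s8 hρ).symm
  have h := Matrix.sum_trace_mul_le_of_pairwise_mul_eq_zero (E := E)
    (Q := fun y => Matrix.piTensor fun i => P (y i))
    (fun y _ => by
      rw [Matrix.IsHermitian, Matrix.conjTranspose_piTensor]
      simp only [(hherm _).eq])
    (fun y _ => by
      rw [IsIdempotentElem, Matrix.piTensor_mul]
      simp only [hidem])
    (fun y hy y' hy' hne => by
      obtain ⟨i, hi, -⟩ := hexcl y hy y' hy' hne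
      rw [Matrix.piTensor_mul]
      exact Matrix.piTensor_eq_zero hi)
    (Matrix.PosSemidef.piTensor fun _ : Fin L => hρ)
  rw [← Complex.real_le_real]
  push_cast
  simpa only [hreal, Matrix.piTensor_mul, Matrix.trace_piTensor, hρtr, Finset.prod_const_one]
    using h
end

section
/- (Quantum LO hierarchy, level L) In the setting of N parties with projective measurements {m^{(i,x_i)}_{y_i}} on ℂ^{d_i} and a density matrix ρ on the composite space, let p(y|x) = Tr(P_{(x,y)} * ρ) be the resulting conditional probability distribution, where P_{(x,y)} is the product effect with entries ∏_i m^{(i,x_i)}_{y_i}(a_i,b_i). Call two L-tuples of events ((x^1,y^1),…,(x^L,y^L)) and ((x'^1,y'^1),…,(x'^L,y'^L)) locally orthogonal if there exist an index l and a party i with x^l_i = x'^l_i and y^l_i ≠ y'^l_i. Then for every set E of pairwise locally orthogonal L-tuples of events, ∑_{((x^1,y^1),…,(x^L,y^L))∈E} ∏_{l=1}^L p(y^l|x^l) ≤ 1. -/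
open ComplexOrder

open Matrix

/-- The product of a finite family of square matrices, indexed by tuples: its entries are the
products of the entries of the factors. -/
def piKronecker {ι : Type*} [Fintype ι] {n : ι → Type*} (A : (i : ι) → Matrix (n i) (n i) ℂ) :
    Matrix ((i : ι) → n i) ((i : ι) → n i) ℂ :=
  Matrix.of fun a b => ∏ i, A i (a i) (b i)

section piKronecker

variable {ι : Type*} [Fintype ι] {n : ι → Type*}

theorem piKronecker_mul [DecidableEq ι] [∀ i, Fintype (n i)]
    (A B : (i : ι) → Matrix (n i) (n i) ℂ) :
    piKronecker A * piKronecker B = piKronecker fun i => A i * B i := by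
  ext a b
  simp only [piKronecker, Matrix.mul_apply, Matrix.of_apply, Finset.prod_univ_sum,
    Fintype.piFinset_univ, Finset.prod_mul_distrib]

theorem piKronecker_conjTranspose (A : (i : ι) → Matrix (n i) (n i) ℂ) :
    (piKronecker A)ᴴ = piKronecker fun i => (A i)ᴴ := by
  ext a b
  simp [piKronecker, Matrix.conjTranspose_apply]

theorem piKronecker_trace [DecidableEq ι] [∀ i, Fintype (n i)]
    (A : (i : ι) → Matrix (n i) (n i) ℂ) :
    (piKronecker A).trace = ∏ i, (A i).trace := by
  simp only [piKronecker, Matrix.trace, Matrix.diag, Matrix.of_apply, Finset.prod_univ_sum,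
    Fintype.piFinset_univ]

theorem piKronecker_eq_zero {A : (i : ι) → Matrix (n i) (n i) ℂ} (h : ∃ i, A i = 0) :
    piKronecker A = 0 := by
  obtain ⟨i, hi⟩ := h
  ext a b
  exact Finset.prod_eq_zero (Finset.mem_univ i) (by simp [hi])

open scoped MatrixOrder Matrix.Norms.L2Operator in
theorem piKronecker_posSemidef [DecidableEq ι] [∀ i, Fintype (n i)] [∀ i, DecidableEq (n i)]
    {A : (i : ι) → Matrix (n i) (n i) ℂ} (hA : ∀ i, (A i).PosSemidef) :
    (piKronecker A).PosSemidef := by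
  choose B hB using fun i => CStarAlgebra.nonneg_iff_eq_star_mul_self.mp (hA i).nonneg
  have h : piKronecker A = (piKronecker B)ᴴ * piKronecker B := by
    rw [piKronecker_conjTranspose, piKronecker_mul]
    exact congrArg _ (funext hB)
  rw [h]
  exact Matrix.posSemidef_conjTranspose_mul_self _

end piKronecker

section IsStarProjection

variable {n : Type*} [Fintype n]

/-- The effects of a projective measurement are pairwise orthogonal. -/
theorem mul_eq_zero_of_sum_eq_one [DecidableEq n] {Y : Type*} [Fintype Y]
    {P : Y → Matrix n n ℂ} (hP : ∀ y, IsStarProjection (P y)) (hsum : ∑ y, P y = 1)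
    {y z : Y} (hyz : y ≠ z) : P y * P z = 0 := by
  classical
  have hsq (w : Y) : (P w * P z)ᴴ * (P w * P z) = P z * P w * P z := by
    rw [Matrix.conjTranspose_mul, ← Matrix.star_eq_conjTranspose, ← Matrix.star_eq_conjTranspose,
      (hP w).isSelfAdjoint.star_eq, (hP z).isSelfAdjoint.star_eq]
    simp only [← mul_assoc]
    rw [mul_assoc (P z) (P w) (P w), (hP w).isIdempotentElem.eq]
  have htotal : ∑ w, P z * P w * P z = P z := by
    rw [← Finset.sum_mul, ← Finset.mul_sum, hsum, mul_one, (hP z).isIdempotentElem.eq]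
  have hrest : ∑ w ∈ Finset.univ.erase z, ((P w * P z)ᴴ * (P w * P z)).trace = 0 := by
    rw [← Finset.add_sum_erase _ _ (Finset.mem_univ z), (hP z).isIdempotentElem.eq,
      (hP z).isIdempotentElem.eq, add_eq_left] at htotal
    simp only [hsq, ← Matrix.trace_sum, htotal, Matrix.trace_zero]
  rw [Finset.sum_eq_zero_iff_of_nonneg
    fun w _ => (Matrix.posSemidef_conjTranspose_mul_self _).trace_nonneg] at hrest
  exact Matrix.trace_conjTranspose_mul_self_eq_zero_iff.mp
    (hrest y (Finset.mem_erase.mpr ⟨hyz, Finset.mem_univ y⟩))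

theorem IsStarProjection.trace_mul_nonneg {T σ : Matrix n n ℂ} (hT : IsStarProjection T)
    (hσ : σ.PosSemidef) : 0 ≤ (T * σ).trace := by
  have h := (hσ.mul_mul_conjTranspose_same T).trace_nonneg
  rwa [← Matrix.star_eq_conjTranspose, hT.isSelfAdjoint.star_eq, Matrix.trace_mul_comm,
    ← mul_assoc, hT.isIdempotentElem.eq] at h

theorem isStarProjection_sum_of_pairwise_mul_eq_zero {κ : Type*} (E : Finset κ)
    {Q : κ → Matrix n n ℂ} (hQ : ∀ e ∈ E, IsStarProjection (Q e))
    (horth : ∀ e ∈ E, ∀ f ∈ E, e ≠ f → Q e * Q f = 0) :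
    IsStarProjection (∑ e ∈ E, Q e) := by
  classical
  refine ⟨?_, isSelfAdjoint_sum E fun e he => (hQ e he).isSelfAdjoint⟩
  rw [IsIdempotentElem, Finset.sum_mul_sum]
  refine Finset.sum_congr rfl fun e he => ?_
  rw [Finset.sum_eq_single_of_mem e he fun f hf hfe => horth e he f hf hfe.symm,
    (hQ e he).isIdempotentElem.eq]

theorem sum_trace_mul_le_trace [DecidableEq n] {κ : Type*} (E : Finset κ)
    {Q : κ → Matrix n n ℂ} (hQ : ∀ e ∈ E, IsStarProjection (Q e))
    (horth : ∀ e ∈ E, ∀ f ∈ E, e ≠ f → Q e * Q f = 0)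
    {σ : Matrix n n ℂ} (hσ : σ.PosSemidef) : ∑ e ∈ E, (Q e * σ).trace ≤ σ.trace := by
  have h := (isStarProjection_sum_of_pairwise_mul_eq_zero E hQ horth).one_sub.trace_mul_nonneg hσ
  rwa [sub_mul, one_mul, Matrix.trace_sub, Finset.sum_mul, Matrix.trace_sum, sub_nonneg] at h

theorem piKronecker_isStarProjection {ι : Type*} [Fintype ι] [DecidableEq ι] {k : ι → Type*}
    [∀ i, Fintype (k i)] {A : (i : ι) → Matrix (k i) (k i) ℂ}
    (hA : ∀ i, IsStarProjection (A i)) : IsStarProjection (piKronecker A) := by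
  refine ⟨?_, ?_⟩
  · rw [IsIdempotentElem, piKronecker_mul]
    exact congrArg _ (funext fun i => (hA i).isIdempotentElem.eq)
  · rw [IsSelfAdjoint, Matrix.star_eq_conjTranspose, piKronecker_conjTranspose]
    exact congrArg _ (funext fun i => (hA i).isSelfAdjoint.star_eq)

end IsStarProjection

/-- Quantum LO hierarchy at level `L`: with `p(y|x) = Tr(P_(x,y) * ρ)` generated by local
projective measurements on a density matrix `ρ`, for every set `E` of pairwise locally
orthogonal `L`-tuples of events (some copy `l` and some party `i` have the same setting
but different outcomes), the products `∏ l, p(y^l|x^l)` sum to at most `1`. -/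
theorem quantum_LO_hierarchy {N L : ℕ} (d : Fin N → ℕ)
    (X Y : Fin N → Type*) [∀ i, Fintype (X i)] [∀ i, Fintype (Y i)]
    (m : (i : Fin N) → X i → Y i → Matrix (Fin (d i)) (Fin (d i)) ℂ)
    (hherm : ∀ i x y, (m i x y).IsHermitian)
    (hidem : ∀ i x y, m i x y * m i x y = m i x y)
    (hsum : ∀ i x, ∑ y, m i x y = 1)
    (ρ : Matrix ((i : Fin N) → Fin (d i)) ((i : Fin N) → Fin (d i)) ℂ)
    (hρ : ρ.PosSemidef) (hρtr : ρ.trace = 1)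
    (E : Finset (Fin L → (((i : Fin N) → X i) × ((i : Fin N) → Y i))))
    (hLO : ∀ e ∈ E, ∀ e' ∈ E, e ≠ e' →
      ∃ l i, (e l).1 i = (e' l).1 i ∧ (e l).2 i ≠ (e' l).2 i) :
    ∑ e ∈ E, ∏ l,
      ((Matrix.of (fun (a b : (i : Fin N) → Fin (d i)) => ∏ i, m i ((e l).1 i) ((e l).2 i) (a i) (b i)) * ρ).trace).re
      ≤ 1 := by
  have hm (i x y) : IsStarProjection (m i x y) := ⟨hidem i x y, hherm i x y⟩
  let P (v : ((i : Fin N) → X i) × ((i : Fin N) → Y i)) :=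
    piKronecker fun i => m i (v.1 i) (v.2 i)
  have hP (v) : IsStarProjection (P v) := piKronecker_isStarProjection fun i => hm _ _ _
  have horth : ∀ e ∈ E, ∀ f ∈ E, e ≠ f →
      piKronecker (fun l => P (e l)) * piKronecker (fun l => P (f l)) = 0 := by
    intro e he f hf hef
    obtain ⟨l, i, hx, hy⟩ := hLO e he f hf hef
    rw [piKronecker_mul]
    refine piKronecker_eq_zero ⟨l, ?_⟩
    rw [piKronecker_mul]
    refine piKronecker_eq_zero ⟨i, ?_⟩
    rw [← hx]
    exact mul_eq_zero_of_sum_eq_one (hm i _) (hsum i _) hy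
  have hle := sum_trace_mul_le_trace E
    (fun e _ => piKronecker_isStarProjection fun l => hP (e l)) horth
    (piKronecker_posSemidef fun _ : Fin L => hρ)
  simp only [piKronecker_mul, piKronecker_trace, hρtr, Finset.prod_const_one] at hle
  have hre (v) : (P v * ρ).trace = (((P v * ρ).trace.re : ℝ) : ℂ) :=
    Complex.eq_re_of_ofReal_le ((hP v).trace_mul_nonneg hρ)
  rw [Finset.sum_congr rfl fun e _ => Finset.prod_congr rfl fun l _ => hre (e l)] at hle
  exact_mod_cast hle
end

section
/- (Sharp Bell inequalities from disconnected cliques) Let X_1,…,X_N and Y_1,…,Y_N be finite nonempty sets, and call e = (x,y) with x ∈ ∏_i X_i, y ∈ ∏_i Y_i an event; events e = (x,y) and e' = (x',y') are locally orthogonal if there is a party i with x_i = x'_i and y_i ≠ y'_i. Let q be a probability distribution on ∏_i X_i, let ω(x,y) ≥ 0 be payoffs, and let p(y|x) be conditional probabilities (p(y|x) ≥ 0 and ∑_y p(y|x) = 1 for each x) satisfying Local Orthogonality: for every set S of pairwise locally orthogonal events, ∑_{(x,y)∈S} p(y|x) ≤ 1. Suppose the set of events with q(x)·ω(x,y) >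 0 is partitioned into nonempty sets C_1,…,C_K such that any two events lying in distinct sets C_k, C_{k'} (k ≠ k') are locally orthogonal. Then the expected payoff satisfies ∑_{x,y} q(x) ω(x,y) p(y|x) ≤ max_{1≤k≤K} ∑_{(x,y)∈C_k} q(x) ω(x,y). -/
/-- Sharp Bell inequalities from disconnected cliques: in an `N`-party game with input
distribution `q` and nonnegative payoffs `ω`, if the set of events with positive weight
`q x * ω (x, y)` is partitioned into nonempty sets `C 1, …, C K` such that events in
distinct sets are locally orthogonal, then every conditional probability distribution
`p` satisfying Local Orthogonality has expected payoff at most the classical value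
`max_k ∑_{(x,y) ∈ C k} q x * ω (x, y)`. -/
theorem sharp_bell_from_disconnected_cliques {N K : ℕ} (hK : 0 < K)
    (X Y : Fin N → Type*) [∀ i, Fintype (X i)] [∀ i, Fintype (Y i)]
    (q : ((i : Fin N) → X i) → ℝ)
    (hq0 : ∀ x, 0 ≤ q x) (hq1 : ∑ x, q x = 1)
    (ω : (((i : Fin N) → X i) × ((i : Fin N) → Y i)) → ℝ)
    (hω : ∀ e, 0 ≤ ω e)
    (p : ((i : Fin N) → X i) → ((i : Fin N) → Y i) → ℝ)
    (hp0 : ∀ x y, 0 ≤ p x y) (hp1 : ∀ x, ∑ y, p x y = 1)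
    (hLO : ∀ S : Finset (((i : Fin N) → X i) × ((i : Fin N) → Y i)),
      (∀ e ∈ S, ∀ e' ∈ S, e ≠ e' → ∃ i, e.1 i = e'.1 i ∧ e.2 i ≠ e'.2 i) →
      ∑ e ∈ S, p e.1 e.2 ≤ 1)
    (C : Fin K → Finset (((i : Fin N) → X i) × ((i : Fin N) → Y i)))
    (hCnonempty : ∀ k, (C k).Nonempty)
    (hCdisj : ∀ k k', k ≠ k' → Disjoint (C k) (C k'))
    (hCcover : ∀ e, 0 < q e.1 * ω e ↔ ∃ k, e ∈ C k)
    (hCorth : ∀ k k', k ≠ k' → ∀ e ∈ C k, ∀ e' ∈ C k',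
      ∃ i, e.1 i = e'.1 i ∧ e.2 i ≠ e'.2 i) :
    ∑ x, ∑ y, q x * ω (x, y) * p x y ≤
      Finset.univ.sup' (Finset.univ_nonempty_iff.mpr ⟨⟨0, hK⟩⟩)
        (fun k => ∑ e ∈ C k, q e.1 * ω e) := by
  classical
  set M := Finset.univ.sup' (Finset.univ_nonempty_iff.mpr ⟨⟨0, hK⟩⟩)
    (fun k => ∑ e ∈ C k, q e.1 * ω e)
  have hw : ∀ e, 0 ≤ q e.1 * ω e := fun e => mul_nonneg (hq0 _) (hω _)
  have hWM : ∀ k, ∑ e ∈ C k, q e.1 * ω e ≤ M := fun k =>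
    Finset.le_sup' (fun k => ∑ e ∈ C k, q e.1 * ω e) (Finset.mem_univ k)
  have hM0 : 0 ≤ M := (Finset.sum_nonneg fun e _ => hw e).trans (hWM ⟨0, hK⟩)
  -- a most likely event in each clique
  choose r hrC hrmax using fun k =>
    Finset.exists_max_image (C k) (fun e => p e.1 e.2) (hCnonempty k)
  have hrinj : Function.Injective r := by
    intro k k' h
    by_contra hne
    exact Finset.disjoint_left.mp (hCdisj k k' hne) (hrC k) (h ▸ hrC k')
  have hr1 : ∑ k, p (r k).1 (r k).2 ≤ 1 := by
    have h := hLO (Finset.univ.map ⟨r, hrinj⟩) (by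
      simp only [Finset.mem_map, Finset.mem_univ, true_and, Function.Embedding.coeFn_mk]
      rintro _ ⟨k, rfl⟩ _ ⟨k', rfl⟩ hne
      exact hCorth k k' (fun h => hne (h ▸ rfl)) _ (hrC k) _ (hrC k'))
    simpa using h
  calc ∑ x, ∑ y, q x * ω (x, y) * p x y
      = ∑ e : ((i : Fin N) → X i) × ((i : Fin N) → Y i), q e.1 * ω e * p e.1 e.2 :=
        (Fintype.sum_prod_type
          (fun e : ((i : Fin N) → X i) × ((i : Fin N) → Y i) =>
            q e.1 * ω e * p e.1 e.2)).symm
    _ = ∑ e ∈ Finset.univ.biUnion C, q e.1 * ω e * p e.1 e.2 := by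
        refine (Finset.sum_subset (Finset.subset_univ _) fun e _ he => ?_).symm
        have hnot : ¬ 0 < q e.1 * ω e := fun h => he (by simpa using (hCcover e).mp h)
        rw [le_antisymm (not_lt.mp hnot) (hw e), zero_mul]
    _ = ∑ k, ∑ e ∈ C k, q e.1 * ω e * p e.1 e.2 :=
        Finset.sum_biUnion fun k _ k' _ h => hCdisj k k' h
    _ ≤ ∑ k, M * p (r k).1 (r k).2 := by
        refine Finset.sum_le_sum fun k _ => ?_
        calc ∑ e ∈ C k, q e.1 * ω e * p e.1 e.2
            ≤ ∑ e ∈ C k, q e.1 * ω e * p (r k).1 (r k).2 :=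
              Finset.sum_le_sum fun e he => mul_le_mul_of_nonneg_left (hrmax k e he) (hw e)
          _ = (∑ e ∈ C k, q e.1 * ω e) * p (r k).1 (r k).2 := (Finset.sum_mul ..).symm
          _ ≤ M * p (r k).1 (r k).2 := mul_le_mul_of_nonneg_right (hWM k) (hp0 _ _)
    _ = M * ∑ k, p (r k).1 (r k).2 := (Finset.mul_sum ..).symm
    _ ≤ M := mul_le_of_le_one_right hM0 hr1
end

section
/- Let {P_x}_{x∈X} be a projective measurement on ℂ^d (Hermitian idempotent matrices summing to the identity, necessarily with P_x P_{x'} = 0 for x ≠ x') and let {n_y}_{y∈Y} be a POVM that is compatible with {P_x}, i.e., there exists a family of positive semidefinite matrices {r_{x,y}} with ∑_y r_{x,y} = P_x for every x and ∑_x r_{x,y} = n_y for every y. Then the Lüders instrument of {P_x} does not disturb {n_y}: for every d×d matrix ρ and every y ∈ Y, ∑_{x∈X} Tr(n_y * (P_x * ρ * P_x)) = Tr(n_y * ρ). -/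
open ComplexOrder

namespace Matrix

open scoped MatrixOrder

/-- If a sum of positive semidefinite matrices annihilates `B`, then so does each summand. -/
lemma PosSemidef.mul_eq_zero_of_sum_mul_eq_zero {ι m k : Type*} [Fintype m] [Fintype k]
    {s : Finset ι} {M : ι → Matrix m m ℂ} (hM : ∀ i ∈ s, (M i).PosSemidef) {B : Matrix m k ℂ}
    (h : (∑ i ∈ s, M i) * B = 0) {i : ι} (hi : i ∈ s) : M i * B = 0 := by
  classical
  have hsum : ∑ j ∈ s, Bᴴ * M j * B = 0 := by
    rw [← Matrix.sum_mul, ← Matrix.mul_sum, Matrix.mul_assoc, h, Matrix.mul_zero]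
  have hzero : Bᴴ * M i * B = 0 :=
    (Finset.sum_eq_zero_iff_of_nonneg fun j hj =>
      ((hM j hj).conjTranspose_mul_mul_same B).nonneg).1 hsum i hi
  obtain ⟨C, hC⟩ := CStarAlgebra.nonneg_iff_eq_star_mul_self.mp (hM i hi).nonneg
  rw [star_eq_conjTranspose] at hC
  have hCB : C * B = 0 := by
    rw [← conjTranspose_mul_self_eq_zero, conjTranspose_mul, ← hzero, hC]
    simp only [Matrix.mul_assoc]
  rw [hC, Matrix.mul_assoc, hCB, Matrix.mul_zero]

/-- Hermitian idempotents summing to the identity are pairwise orthogonal. -/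
lemma mul_eq_zero_of_isHermitian_of_idempotent_of_sum_eq_one {ι m : Type*} [Fintype ι]
    [Fintype m] [DecidableEq m] {P : ι → Matrix m m ℂ} (hherm : ∀ i, (P i).IsHermitian)
    (hidem : ∀ i, P i * P i = P i) (hsum : ∑ i, P i = 1) {i j : ι} (hij : i ≠ j) :
    P i * P j = 0 := by
  classical
  have hpos : ∀ i, (P i).PosSemidef := fun i => by
    have := posSemidef_conjTranspose_mul_self (P i)
    rwa [(hherm i).eq, hidem i] at this
  refine PosSemidef.mul_eq_zero_of_sum_mul_eq_zero (s := Finset.univ.erase j)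
    (fun i _ => hpos i) ?_ (Finset.mem_erase.2 ⟨hij, Finset.mem_univ i⟩)
  rw [Finset.sum_erase_eq_sub (Finset.mem_univ j), hsum, Matrix.sub_mul, Matrix.one_mul, hidem,
    sub_self]

end Matrix

/-- Minimal disturbance of Lüders instruments: if the POVM `{n y}` is compatible with the
projective measurement `{P x}` (there is a joint POVM `{r x y}` with the right marginals),
then the Lüders instrument of `{P x}` does not disturb `{n y}`:
`∑ x, Tr(n y * (P x * ρ * P x)) = Tr(n y * ρ)` for every `ρ` and `y`. -/
theorem lueders_minimal_disturbance {d : ℕ} {X Y : Type*} [Fintype X] [Fintype Y]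
    (P : X → Matrix (Fin d) (Fin d) ℂ)
    (hherm : ∀ x, (P x).IsHermitian)
    (hidem : ∀ x, P x * P x = P x)
    (hPsum : ∑ x, P x = 1)
    (n : Y → Matrix (Fin d) (Fin d) ℂ)
    (hnpos : ∀ y, (n y).PosSemidef)
    (hnsum : ∑ y, n y = 1)
    (r : X → Y → Matrix (Fin d) (Fin d) ℂ)
    (hrpos : ∀ x y, (r x y).PosSemidef)
    (hrP : ∀ x, ∑ y, r x y = P x)
    (hrn : ∀ y, ∑ x, r x y = n y)
    (ρ : Matrix (Fin d) (Fin d) ℂ) (y : Y) :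
    ∑ x, (n y * (P x * ρ * P x)).trace = (n y * ρ).trace := by
  have hright : ∀ x, r x y * P x = r x y := fun x => by
    have h : r x y * (1 - P x) = 0 :=
      Matrix.PosSemidef.mul_eq_zero_of_sum_mul_eq_zero (fun y _ => hrpos x y)
        (by rw [hrP, Matrix.mul_sub, Matrix.mul_one, hidem, sub_self]) (Finset.mem_univ y)
    rw [Matrix.mul_sub, Matrix.mul_one, sub_eq_zero] at h
    exact h.symm
  have hleft : ∀ x, P x * r x y = r x y := fun x => by
    have h := congrArg Matrix.conjTranspose (hright x)
    rwa [Matrix.conjTranspose_mul, (hherm x).eq, (hrpos x y).isHermitian.eq] at h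
  have horth : ∀ {x x' : X}, x ≠ x' → P x * P x' = 0 := fun hne =>
    Matrix.mul_eq_zero_of_isHermitian_of_idempotent_of_sum_eq_one hherm hidem hPsum hne
  have hnP : ∀ x, n y * P x = r x y := fun x => by
    rw [← hrn, Matrix.sum_mul, Finset.sum_eq_single x, hright]
    · intro x' _ hne
      rw [← hright x', Matrix.mul_assoc, horth hne, Matrix.mul_zero]
    · simp
  calc ∑ x, (n y * (P x * ρ * P x)).trace = ∑ x, (r x y * ρ).trace := by
        refine Finset.sum_congr rfl fun x _ => ?_
        rw [← Matrix.mul_assoc, ← Matrix.mul_assoc, hnP, Matrix.trace_mul_comm,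
          ← Matrix.mul_assoc, hleft]
    _ = (n y * ρ).trace := by rw [← Matrix.trace_sum, ← Matrix.sum_mul, hrn]
end

section
/- (Guess the Parity) Let N be a positive even integer. Events are pairs (x, y) with x, y ∈ {0,1}^N; the winning output for input x is the constant string y with y_i = x_1 ⊕ x_2 ⊕ … ⊕ x_N for all i. Two events (x,y), (x',y') are locally orthogonal if there is an index i with x_i = x'_i and y_i ≠ y'_i. Let p(y|x) be conditional probabilities (nonnegative, summing to 1 over y for each x) satisfying Local Orthogonality: for every set S of pairwise locally orthogonal events, ∑_{(x,y)∈S} p(y|x) ≤ 1. Then the winning probability under uniformly random inputs satisfies 2^{-N} ∑_{x∈{0,1}^N} p(win(x)|x) ≤ 1/2, where win(x) is the winning output for x. In particular, any two winning events whose inputs have different parity are locally orthogonal. -/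
/-- For even `N`, bit strings of different parity agree in some coordinate, since the complement
of a string has the same parity. -/
lemma exists_eq_of_sum_ne_sum {N : ℕ} (hN : Even N) {x x' : Fin N → ZMod 2}
    (h : ∑ i, x i ≠ ∑ i, x' i) : ∃ i, x i = x' i := by
  by_contra! hne
  have bit_ne : ∀ a b : ZMod 2, a ≠ b → a = b + 1 := by decide
  apply h
  have hcast : (N : ZMod 2) = 0 := (ZMod.natCast_eq_zero_iff_even).2 hN
  rw [Finset.sum_congr rfl fun i _ => bit_ne _ _ (hne i)]
  simp [Finset.sum_add_distrib, hcast]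

/-- Flipping one bit of a string flips its parity. -/
lemma sum_add_single_one {N : ℕ} (k : Fin N) (x : Fin N → ZMod 2) :
    ∑ i, (x + Pi.single k 1 : Fin N → ZMod 2) i = ∑ i, x i + 1 := by
  simp [Finset.sum_add_distrib]

/-- Guess the Parity: `N` parties (`N` positive and even) receive input bits
`x : Fin N → ZMod 2` and win if every output equals the parity `∑ i, x i`.  If the
conditional probabilities `p` satisfy Local Orthogonality, then the winning probability
under uniformly random inputs is at most `1/2`.  In particular, any two winning events
whose inputs have different parity are locally orthogonal. -/
theorem guess_the_parity_LO_bound {N : ℕ} (hNpos : 0 < N) (hNeven : Even N)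
    (p : (Fin N → ZMod 2) → (Fin N → ZMod 2) → ℝ)
    (hp0 : ∀ x y, 0 ≤ p x y) (hp1 : ∀ x, ∑ y, p x y = 1)
    (hLO : ∀ S : Finset ((Fin N → ZMod 2) × (Fin N → ZMod 2)),
      (∀ e ∈ S, ∀ e' ∈ S, e ≠ e' → ∃ i, e.1 i = e'.1 i ∧ e.2 i ≠ e'.2 i) →
      ∑ e ∈ S, p e.1 e.2 ≤ 1) :
    (1 / 2 ^ N : ℝ) * ∑ x : Fin N → ZMod 2, p x (fun _ => ∑ i, x i) ≤ 1 / 2 ∧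
    (∀ x x' : Fin N → ZMod 2, (∑ i, x i) ≠ (∑ i, x' i) →
      ∃ i, x i = x' i ∧
        (fun _ : Fin N => ∑ j, x j) i ≠ (fun _ : Fin N => ∑ j, x' j) i) := by
  have horth : ∀ x x' : Fin N → ZMod 2, (∑ i, x i) ≠ (∑ i, x' i) →
      ∃ i, x i = x' i ∧
        (fun _ : Fin N => ∑ j, x j) i ≠ (fun _ : Fin N => ∑ j, x' j) i := fun x x' h =>
    (exists_eq_of_sum_ne_sum hNeven h).imp fun _ hi => ⟨hi, h⟩
  refine ⟨?_, horth⟩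
  let win (x : Fin N → ZMod 2) : ℝ := p x (fun _ => ∑ i, x i)
  let flip : (Fin N → ZMod 2) := Pi.single ⟨0, hNpos⟩ 1
  have hpair : ∀ x, win x + win (x + flip) ≤ 1 := by
    intro x
    have hpar : ∑ i, x i ≠ ∑ i, (x + flip) i := by
      rw [sum_add_single_one]
      simp
    have hne : x ≠ x + flip := fun h => hpar (congrArg (fun z => ∑ i, z i) h)
    have hS := hLO {(x, fun _ => ∑ i, x i), (x + flip, fun _ => ∑ i, (x + flip) i)} (by
      intro e he e' he' hee
      simp only [Finset.mem_insert, Finset.mem_singleton] at he he'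
      rcases he with rfl | rfl <;> rcases he' with rfl | rfl
      · exact absurd rfl hee
      · exact horth _ _ hpar
      · exact horth _ _ hpar.symm
      · exact absurd rfl hee)
    rwa [Finset.sum_pair fun h => hne (congrArg Prod.fst h)] at hS
  have hsum : ∑ x, (win x + win (x + flip)) ≤ 2 ^ N :=
    (Finset.sum_le_sum fun x _ => hpair x).trans_eq (by simp)
  have hflip : ∑ x, win (x + flip) = ∑ x, win x :=
    Equiv.sum_comp (Equiv.addRight flip) win
  rw [Finset.sum_add_distrib, hflip] at hsum
  change (1 / 2 ^ N : ℝ) * ∑ x, win x ≤ 1 / 2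
  rw [one_div_mul_eq_div, div_le_iff₀ (by positivity)]
  linarith
end

section
/- (PR-box correlations violate the LO hierarchy at level 2) Define the Popescu–Rohrlich distribution p(y_1,y_2|x_1,x_2) for bits x_1,x_2,y_1,y_2 ∈ {0,1} by p = 1/2 if y_1 ⊕ y_2 = x_1·x_2 and p = 0 otherwise. Consider two independent copies: a level-2 event is a pair e = ((x,y),(x',y')) of events of the bipartite game with probability P(e) = p(y|x)·p(y'|x'); two level-2 events are locally orthogonal if in at least one of the four party slots the two events have the same input and different outputs. Then there exists a finite set E of pairwise locally orthogonal level-2 events with ∑_{e∈E} P(e) > 1; hence the PR box does not satisfy Local Orthogonality at level 2. -/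
/-- A single-copy event of the bipartite game: a pair `(x, y)` of an input pair
`x = (x₁, x₂)` and an output pair `y = (y₁, y₂)` of bits. -/
abbrev PREvent : Type := (ZMod 2 × ZMod 2) × (ZMod 2 × ZMod 2)

/-- The Popescu–Rohrlich distribution: `p(y₁ y₂ | x₁ x₂) = 1/2` if `y₁ + y₂ = x₁ * x₂`
and `0` otherwise. -/
noncomputable def prBox (e : PREvent) : ℝ :=
  if e.2.1 + e.2.2 = e.1.1 * e.1.2 then 1 / 2 else 0

/-- Two level-2 events (pairs of single-copy events) are locally orthogonal iff in at
least one of the four party slots they have the same input and different outputs. -/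
def LO2 (e f : PREvent × PREvent) : Prop :=
  (e.1.1.1 = f.1.1.1 ∧ e.1.2.1 ≠ f.1.2.1) ∨
  (e.1.1.2 = f.1.1.2 ∧ e.1.2.2 ≠ f.1.2.2) ∨
  (e.2.1.1 = f.2.1.1 ∧ e.2.2.1 ≠ f.2.2.1) ∨
  (e.2.1.2 = f.2.1.2 ∧ e.2.2.2 ≠ f.2.2.2)

set_option maxRecDepth 10000 in
/-- PR-box correlations violate the LO hierarchy at level 2: there is a finite set of
pairwise locally orthogonal level-2 events whose total probability, computed from two
independent copies of the PR box, exceeds `1`. -/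
theorem pr_box_violates_LO_level_two :
    ∃ E : Finset (PREvent × PREvent),
      (∀ e ∈ E, ∀ f ∈ E, e ≠ f → LO2 e f) ∧
      1 < ∑ e ∈ E, prBox e.1 * prBox e.2 := by
  let E : Finset (PREvent × PREvent) :=
    {(((0, 0), (0, 0)), ((0, 0), (0, 0))),
     (((0, 0), (1, 1)), ((1, 1), (1, 0))),
     (((0, 1), (0, 0)), ((1, 0), (1, 1))),
     (((1, 0), (1, 1)), ((1, 1), (0, 1))),
     (((1, 1), (0, 1)), ((0, 1), (1, 1)))}
  have h_quarter : ∀ e ∈ E, prBox e.1 * prBox e.2 = 1 / 4 := by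
    intro e he
    have h_support : ∀ e ∈ E, e.1.2.1 + e.1.2.2 = e.1.1.1 * e.1.1.2 ∧
        e.2.2.1 + e.2.2.2 = e.2.1.1 * e.2.1.2 := by decide
    obtain ⟨h₁, h₂⟩ := h_support e he
    rw [prBox, prBox, if_pos h₁, if_pos h₂]
    norm_num
  refine ⟨E, ?_, ?_⟩
  · unfold LO2
    decide
  · have h_card : E.card = 5 := by decide
    rw [Finset.sum_congr rfl h_quarter, Finset.sum_const, h_card]
    norm_num
end
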